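/- arXiv:2204.10032 — 5 statements merged into one kernel-verified Lean document; each statement's English description precedes it below -/
import Mathlib

section
/- Let D be a dissipation distance density. Then there exist an open neighborhood U of SO(3) contained in GL₊(3) and a constant c' > 0 such that for every F ∈ U and every G ∈ ℝ^{3×3} one has ∂²_{F₁²}D²(F,F)[G,G] ≥ c' |sym(FᵀG)|². -/
open Matrix Filter Topology

noncomputable section

attribute [local instance] Matrix.normedAddCommGroup Matrix.normedSpace

/-- Real `3 × 3` matrices. -/
abbrev Mat3 := Matrix (Fin 3) (Fin 3) ℝ

/-- Squared Frobenius norm. -/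
def frobSq (A : Mat3) : ℝ := ∑ i, ∑ j, (A i j) ^ 2

/-- Frobenius norm. -/
def frobNorm (A : Mat3) : ℝ := Real.sqrt (frobSq A)

/-- Symmetric part of a matrix. -/
def symPart (A : Mat3) : Mat3 := (2 : ℝ)⁻¹ • (A + Aᵀ)

/-- Matrices with positive determinant. -/
def GLp : Set Mat3 := {F | 0 < F.det}

/-- The special orthogonal group `SO(3)`. -/
def SO3 : Set Mat3 := {Q | Qᵀ * Q = 1 ∧ Q.det = 1}

/-- The second Fréchet derivative of `F ↦ D(F, F₂)²` at `F₁`, applied to `(G, H)`. -/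
def D2bil (D : Mat3 → Mat3 → ℝ) (F₁ F₂ G H : Mat3) : ℝ :=
  iteratedFDeriv ℝ 2 (fun F => (D F F₂) ^ 2) F₁ ![G, H]

/-- A dissipation distance density `D : GL₊(3) × GL₊(3) → [0,∞)`, satisfying
conditions (i)–(vi). -/
structure IsDissipationDensity (D : Mat3 → Mat3 → ℝ) : Prop where
  nonneg : ∀ F₁ ∈ GLp, ∀ F₂ ∈ GLp, 0 ≤ D F₁ F₂
  eq_zero : ∀ F₁ ∈ GLp, ∀ F₂ ∈ GLp, F₁ᵀ * F₁ = F₂ᵀ * F₂ → D F₁ F₂ = 0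
  pos_of_ne : ∀ F₁ ∈ GLp, ∀ F₂ ∈ GLp, F₁ᵀ * F₁ ≠ F₂ᵀ * F₂ → 0 < D F₁ F₂
  symm : ∀ F₁ ∈ GLp, ∀ F₂ ∈ GLp, D F₁ F₂ = D F₂ F₁
  triangle : ∀ F₁ ∈ GLp, ∀ F₂ ∈ GLp, ∀ F₃ ∈ GLp, D F₁ F₃ ≤ D F₁ F₂ + D F₂ F₃
  smooth : ∃ V : Set (Mat3 × Mat3), IsOpen V ∧ SO3 ×ˢ SO3 ⊆ V ∧ V ⊆ GLp ×ˢ GLp ∧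
    ContDiffOn ℝ 3 (fun p : Mat3 × Mat3 => (D p.1 p.2) ^ 2) V
  frame_indiff : ∀ Q₁ ∈ SO3, ∀ Q₂ ∈ SO3, ∀ F₁ ∈ GLp, ∀ F₂ ∈ GLp,
    D (Q₁ * F₁) (Q₂ * F₂) = D F₁ F₂
  coercive : ∃ c > (0 : ℝ), ∀ G : Mat3, c * frobSq (symPart G) ≤ D2bil D 1 1 G G

lemma isOpen_GLp : IsOpen GLp :=
  isOpen_lt continuous_const (Continuous.matrix_det continuous_id)

lemma SO3_mul_GLp {Q F : Mat3} (hQ : Q ∈ SO3) (hF : F ∈ GLp) : Q * F ∈ GLp := by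
  have h1 : Q.det = 1 := hQ.2
  have h2 : 0 < F.det := hF
  show 0 < (Q * F).det
  rw [Matrix.det_mul, h1, one_mul]; exact h2

lemma SO3_transpose {Q : Mat3} (hQ : Q ∈ SO3) : Qᵀ ∈ SO3 := by
  refine ⟨?_, ?_⟩
  · rw [Matrix.transpose_transpose]
    exact mul_eq_one_comm.mp hQ.1
  · rw [Matrix.det_transpose]; exact hQ.2

def mulR (F : Mat3) : Mat3 →L[ℝ] Mat3 := LinearMap.toContinuousLinearMap (LinearMap.mulRight ℝ F)

def mulL (F : Mat3) : Mat3 →L[ℝ] Mat3 := LinearMap.toContinuousLinearMap (LinearMap.mulLeft ℝ F)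

lemma mulR_apply (F X : Mat3) : mulR F X = X * F := rfl

lemma mulL_apply (F X : Mat3) : mulL F X = F * X := rfl

section Gen
variable {E : Type*} [NormedAddCommGroup E] [NormedSpace ℝ E]

def h2 (g : E → ℝ) (x u v : E) : ℝ := iteratedFDeriv ℝ 2 g x ![u, v]

lemma h2_eq (g : E → ℝ) (x u v : E) : h2 g x u v = fderiv ℝ (fderiv ℝ g) x u v := by
  rw [h2, iteratedFDeriv_two_apply]; rfl

lemma h2_add_left (g : E → ℝ) (x u v w : E) : h2 g x (u + v) w = h2 g x u w + h2 g x v w := by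
  simp [h2_eq]

lemma h2_add_right (g : E → ℝ) (x u v w : E) : h2 g x w (u + v) = h2 g x w u + h2 g x w v := by
  simp [h2_eq]

lemma h2_smul_left (g : E → ℝ) (x u w : E) (r : ℝ) : h2 g x (r • u) w = r * h2 g x u w := by
  simp [h2_eq]

lemma h2_smul_right (g : E → ℝ) (x u w : E) (r : ℝ) : h2 g x w (r • u) = r * h2 g x w u := by
  simp [h2_eq]

lemma h2_symm {g : E → ℝ} {x : E} (hg : ContDiffAt ℝ 3 g x) (u v : E) :
    h2 g x u v = h2 g x v u := by
  have hs : IsSymmSndFDerivAt ℝ g x := hg.isSymmSndFDerivAt (by simp; norm_num)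
  rw [h2_eq, h2_eq]; exact hs u v

lemma h2_curve {g : E → ℝ} {x v : E} (hg : ContDiffAt ℝ 3 g x) (γ : ℝ → E) (h0 : γ 0 = x)
    (h' : HasDerivAt γ v 0) (hmin : ∀ t Y, g (γ t) ≤ g Y) (w : E) : h2 g x v w = 0 := by
  have hc2 : ContDiffAt ℝ 2 (fderiv ℝ g) x := hg.fderiv_right (by norm_num)
  have hd : DifferentiableAt ℝ (fderiv ℝ g) x := hc2.differentiableAt (by norm_num)
  have h3 : HasFDerivAt (fderiv ℝ g) (fderiv ℝ (fderiv ℝ g) x) (γ 0) := by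
    rw [h0]; exact hd.hasFDerivAt
  have h4 := HasFDerivAt.comp_hasDerivAt (0 : ℝ) h3 h'
  have h5 : (fderiv ℝ g) ∘ γ = fun _ => 0 := by
    funext t
    exact IsLocalMin.fderiv_eq_zero (Filter.Eventually.of_forall fun Y => hmin t Y)
  rw [h5] at h4
  rw [h2_eq, h4.unique (hasDerivAt_const _ _)]; rfl

lemma contDiffAt_slice {f : E × E → ℝ} {X F : E} (hf : ContDiffAt ℝ 3 f (X, F)) :
    ContDiffAt ℝ 3 (fun Y => f (Y, F)) X :=
  ContDiffAt.comp X (f := fun Y => (Y, F)) hf (contDiffAt_id.prodMk contDiffAt_const)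

lemma h2_slice {f : E × E → ℝ} {V : Set (E × E)} (hV : IsOpen V)
    (hf : ContDiffOn ℝ 3 f V) {X F : E} (h : (X, F) ∈ V) (u v : E) :
    h2 (fun Y => f (Y, F)) X u v = h2 f (X, F) (u, 0) (v, 0) := by
  have hi : ∀ Y : E, HasFDerivAt (fun Y : E => (Y, F))
      (ContinuousLinearMap.inl ℝ E E) Y := fun Y => hasFDerivAt_prodMk_left Y F
  have e : fderiv ℝ (fun Y => f (Y, F)) =ᶠ[𝓝 X] fun Y =>
      ((ContinuousLinearMap.compL ℝ E (E × E) ℝ).flip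
        (ContinuousLinearMap.inl ℝ E E)) (fderiv ℝ f (Y, F)) := by
    have : ∀ᶠ Y in 𝓝 X, (Y, F) ∈ V :=
      (hi X).continuousAt.eventually (hV.mem_nhds h)
    filter_upwards [this] with Y hY
    have hc : ContDiffAt ℝ 3 f (Y, F) := hf.contDiffAt (hV.mem_nhds hY)
    have hd : DifferentiableAt ℝ f (Y, F) := hc.differentiableAt (by norm_num)
    exact (HasFDerivAt.comp Y hd.hasFDerivAt (hi Y)).fderiv
  have hc : ContDiffAt ℝ 3 f (X, F) := hf.contDiffAt (hV.mem_nhds h)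
  have hc2 : ContDiffAt ℝ 2 (fderiv ℝ f) (X, F) := hc.fderiv_right (by norm_num)
  have hd : DifferentiableAt ℝ (fderiv ℝ f) (X, F) := hc2.differentiableAt (by norm_num)
  have h1 : HasFDerivAt (fderiv ℝ (fun Y => f (Y, F)))
      (((ContinuousLinearMap.compL ℝ E (E × E) ℝ).flip
        (ContinuousLinearMap.inl ℝ E E)).comp ((fderiv ℝ (fderiv ℝ f) (X, F)).comp
        (ContinuousLinearMap.inl ℝ E E))) X := by
    refine HasFDerivAt.congr_of_eventuallyEq ?_ e
    exact (ContinuousLinearMap.hasFDerivAt _).comp X (HasFDerivAt.comp X hd.hasFDerivAt (hi X))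
  rw [h2_eq, h2_eq, h1.fderiv]
  rfl

lemma h2_cont {T : Type*} [TopologicalSpace T] {g : E → ℝ} {p u : T → E} {t : T}
    (hg : ContDiffAt ℝ 3 g (p t)) (hp : ContinuousAt p t) (hu : ContinuousAt u t) :
    ContinuousAt (fun s => h2 g (p s) (u s) (u s)) t := by
  simp only [h2_eq]
  have hc2 : ContDiffAt ℝ 2 (fderiv ℝ g) (p t) := hg.fderiv_right (by norm_num)
  have hc3 : ContDiffAt ℝ 1 (fderiv ℝ (fderiv ℝ g)) (p t) := hc2.fderiv_right (by norm_num)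
  have hB : ContinuousAt (fun s => fderiv ℝ (fderiv ℝ g) (p s)) t :=
    ContinuousAt.comp (f := p) (g := fderiv ℝ (fderiv ℝ g)) hc3.continuousAt hp
  exact (hB.clm_apply hu).clm_apply hu

lemma h2_equiv (e : E ≃L[ℝ] E) {g k : E → ℝ} {x : E} (h : k =ᶠ[𝓝 x] g ∘ e) (u v : E) :
    h2 k x u v = h2 g (e x) (e u) (e v) := by
  have h2' := (h.iteratedFDeriv ℝ 2).self_of_nhds
  have h3 := e.iteratedFDerivWithin_comp_right g uniqueDiffOn_univ
    (Set.mem_univ (e x)) 2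
  rw [Set.preimage_univ, iteratedFDerivWithin_univ, iteratedFDerivWithin_univ] at h3
  rw [h2, h2, h2', h3, ContinuousMultilinearMap.compContinuousLinearMap_apply]
  congr 1
  funext i
  fin_cases i <;> rfl

end Gen

lemma D2bil_h2 (D : Mat3 → Mat3 → ℝ) (F₁ F₂ G H : Mat3) :
    D2bil D F₁ F₂ G H = h2 (fun Y => (D Y F₂) ^ 2) F₁ G H := rfl

lemma curve_ker {D : Mat3 → Mat3 → ℝ} (hD : IsDissipationDensity D) {F A : Mat3}
    (hF : F ∈ GLp) (hd : ContDiffAt ℝ 3 (fun Y => (D Y F) ^ 2) F)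
    (γ : ℝ → Mat3) (hγ : ∀ t, γ t ∈ SO3) (h0 : γ 0 = 1) (h' : HasDerivAt γ A 0) (H : Mat3) :
    h2 (fun Y => (D Y F) ^ 2) F (A * F) H = 0 := by
  have h1 : HasDerivAt (fun t => mulR F (γ t)) (mulR F A) 0 :=
    (mulR F).hasFDerivAt.comp_hasDerivAt 0 h'
  have h2 : mulR F (γ 0) = F := by rw [mulR_apply, h0, one_mul]
  refine h2_curve hd (fun t => mulR F (γ t)) h2 h1 ?_ H
  intro t Y
  have h3 : D (mulR F (γ t)) F = 0 := by
    apply hD.eq_zero _ (SO3_mul_GLp (hγ t) hF) _ hF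
    rw [Matrix.transpose_mul, Matrix.mul_assoc, ← Matrix.mul_assoc (γ t)ᵀ, (hγ t).1,
      one_mul]
  show (D (mulR F (γ t)) F) ^ 2 ≤ (D Y F) ^ 2
  rw [h3, zero_pow two_ne_zero]
  exact sq_nonneg _

def R1 (t : ℝ) : Mat3 :=
  !![1, 0, 0; 0, Real.cos t, -Real.sin t; 0, Real.sin t, Real.cos t]
def R2 (t : ℝ) : Mat3 :=
  !![Real.cos t, 0, Real.sin t; 0, 1, 0; -Real.sin t, 0, Real.cos t]
def R3 (t : ℝ) : Mat3 :=
  !![Real.cos t, -Real.sin t, 0; Real.sin t, Real.cos t, 0; 0, 0, 1]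
def A1 : Mat3 := !![0, 0, 0; 0, 0, -1; 0, 1, 0]
def A2 : Mat3 := !![0, 0, 1; 0, 0, 0; -1, 0, 0]
def A3 : Mat3 := !![0, -1, 0; 1, 0, 0; 0, 0, 0]

lemma R1_mem (t : ℝ) : R1 t ∈ SO3 := by
  have h := Real.sin_sq_add_cos_sq t
  refine ⟨?_, ?_⟩
  · ext i j
    fin_cases i <;> fin_cases j <;>
      simp [R1, Matrix.mul_apply, Fin.sum_univ_three] <;> nlinarith
  · simp [R1, Matrix.det_fin_three]; nlinarith

lemma R2_mem (t : ℝ) : R2 t ∈ SO3 := by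
  have h := Real.sin_sq_add_cos_sq t
  refine ⟨?_, ?_⟩
  · ext i j
    fin_cases i <;> fin_cases j <;>
      simp [R2, Matrix.mul_apply, Fin.sum_univ_three] <;> nlinarith
  · simp [R2, Matrix.det_fin_three]; nlinarith

lemma R3_mem (t : ℝ) : R3 t ∈ SO3 := by
  have h := Real.sin_sq_add_cos_sq t
  refine ⟨?_, ?_⟩
  · ext i j
    fin_cases i <;> fin_cases j <;>
      simp [R3, Matrix.mul_apply, Fin.sum_univ_three] <;> nlinarith
  · simp [R3, Matrix.det_fin_three]; nlinarith

lemma cos_d : HasDerivAt Real.cos 0 0 := by simpa using Real.hasDerivAt_cos 0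
lemma sin_d : HasDerivAt Real.sin 1 0 := by simpa using Real.hasDerivAt_sin 0
lemma nsin_d : HasDerivAt (fun t => -Real.sin t) (-1) 0 := sin_d.neg

lemma R1_d : HasDerivAt R1 A1 0 := by
  refine hasDerivAt_pi.2 fun i => hasDerivAt_pi.2 fun j => ?_
  fin_cases i <;> fin_cases j <;>
    simp [R1, A1, hasDerivAt_const, cos_d, sin_d, nsin_d]

lemma R2_d : HasDerivAt R2 A2 0 := by
  refine hasDerivAt_pi.2 fun i => hasDerivAt_pi.2 fun j => ?_
  fin_cases i <;> fin_cases j <;>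
    simp [R2, A2, hasDerivAt_const, cos_d, sin_d, nsin_d]

lemma R3_d : HasDerivAt R3 A3 0 := by
  refine hasDerivAt_pi.2 fun i => hasDerivAt_pi.2 fun j => ?_
  fin_cases i <;> fin_cases j <;>
    simp [R3, A3, hasDerivAt_const, cos_d, sin_d, nsin_d]

lemma R_zero : R1 0 = 1 ∧ R2 0 = 1 ∧ R3 0 = 1 := by
  refine ⟨?_, ?_, ?_⟩ <;> ext i j <;> fin_cases i <;> fin_cases j <;> simp [R1, R2, R3]

lemma skew_decomp {A : Mat3} (hA : Aᵀ = -A) :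
    A = A 2 1 • A1 + A 0 2 • A2 + A 1 0 • A3 := by
  have h : ∀ i j, A j i = -A i j := fun i j => congrFun (congrFun hA i) j
  have h00 := h 0 0
  have h11 := h 1 1
  have h22 := h 2 2
  have h01 := h 0 1
  have h02 := h 0 2
  have h12 := h 1 2
  ext i j
  fin_cases i <;> fin_cases j <;> simp [A1, A2, A3] <;> linarith

lemma skew_ker {D : Mat3 → Mat3 → ℝ} (hD : IsDissipationDensity D) {F A : Mat3}
    (hF : F ∈ GLp) (hd : ContDiffAt ℝ 3 (fun Y => (D Y F) ^ 2) F)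
    (hA : Aᵀ = -A) (H : Mat3) :
    h2 (fun Y => (D Y F) ^ 2) F (A * F) H = 0 := by
  rw [skew_decomp hA, Matrix.add_mul, Matrix.add_mul, Matrix.smul_mul, Matrix.smul_mul,
    Matrix.smul_mul, h2_add_left, h2_add_left, h2_smul_left, h2_smul_left, h2_smul_left,
    curve_ker hD hF hd R1 R1_mem R_zero.1 R1_d, curve_ker hD hF hd R2 R2_mem R_zero.2.1 R2_d,
    curve_ker hD hF hd R3 R3_mem R_zero.2.2 R3_d]
  simp

lemma D2bil_joint {D : Mat3 → Mat3 → ℝ} {V : Set (Mat3 × Mat3)} (hV : IsOpen V)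
    (hf : ContDiffOn ℝ 3 (fun p : Mat3 × Mat3 => (D p.1 p.2) ^ 2) V) {F : Mat3} (h : (F, F) ∈ V)
    (G H : Mat3) : D2bil D F F G H =
      h2 (fun p : Mat3 × Mat3 => (D p.1 p.2) ^ 2) (F, F) (G, 0) (H, 0) :=
  h2_slice hV hf h G H

/-- Reduction to the symmetric part. -/
lemma D2bil_reduce {D : Mat3 → Mat3 → ℝ} (hD : IsDissipationDensity D)
    {V : Set (Mat3 × Mat3)} (hV : IsOpen V) (hVG : V ⊆ GLp ×ˢ GLp)
    (hf : ContDiffOn ℝ 3 (fun p : Mat3 × Mat3 => (D p.1 p.2) ^ 2) V) {F : Mat3} (h : (F, F) ∈ V)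
    (G : Mat3) : D2bil D F F G G =
      D2bil D F F ((F⁻¹)ᵀ * symPart (Fᵀ * G)) ((F⁻¹)ᵀ * symPart (Fᵀ * G)) := by
  have hF : F ∈ GLp := (hVG h).1
  have hu : IsUnit F.det := (ne_of_gt (show 0 < F.det from hF)).isUnit
  have hc : ContDiffAt ℝ 3 (fun Y => (D Y F) ^ 2) F :=
    contDiffAt_slice (f := fun p : Mat3 × Mat3 => (D p.1 p.2) ^ 2)
      (hf.contDiffAt (hV.mem_nhds h))
  set W : Mat3 := (2 : ℝ)⁻¹ • (Fᵀ * G - (Fᵀ * G)ᵀ) with hW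
  set A : Mat3 := (F⁻¹)ᵀ * W * F⁻¹ with hA
  have hWs : Wᵀ = -W := by
    rw [hW, Matrix.transpose_smul, Matrix.transpose_sub, Matrix.transpose_transpose, ← smul_neg,
      neg_sub]
  have hAs : Aᵀ = -A := by
    rw [hA, Matrix.transpose_mul, Matrix.transpose_mul, Matrix.transpose_transpose, hWs]
    simp [Matrix.mul_assoc]
  have hinv : (F⁻¹)ᵀ * Fᵀ = 1 := by
    rw [← Matrix.transpose_mul, Matrix.mul_nonsing_inv _ hu, Matrix.transpose_one]
  have hAF : A * F = (F⁻¹)ᵀ * W := by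
    rw [hA, Matrix.mul_assoc, Matrix.nonsing_inv_mul _ hu, Matrix.mul_one]
  have hsum : symPart (Fᵀ * G) + W = Fᵀ * G := by
    rw [hW, symPart, ← smul_add, add_add_sub_cancel, ← two_smul ℝ (Fᵀ * G), smul_smul]
    norm_num
  have hG : G = (F⁻¹)ᵀ * symPart (Fᵀ * G) + A * F := by
    rw [hAF, ← Matrix.mul_add, hsum, ← Matrix.mul_assoc, hinv, Matrix.one_mul]
  have hk := skew_ker hD hF hc hAs
  rw [D2bil_h2, D2bil_h2]
  generalize (F⁻¹)ᵀ * symPart (Fᵀ * G) = P at hG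
  rw [hG, h2_add_left, hk, h2_add_right, h2_symm hc P (A * F), hk, add_zero, add_zero]

lemma D2bil_rot {D : Mat3 → Mat3 → ℝ} (hD : IsDissipationDensity D) {Q F : Mat3}
    (hQ : Q ∈ SO3) (hF : F ∈ GLp) (G : Mat3) :
    D2bil D F F G G = D2bil D (Q * F) (Q * F) (Q * G) (Q * G) := by
  have hQ1 : Qᵀ * Q = 1 := hQ.1
  have hQ2 : Q * Qᵀ = 1 := mul_eq_one_comm.mp hQ1
  let e : Mat3 ≃L[ℝ] Mat3 := ContinuousLinearEquiv.equivOfInverse (mulL Q) (mulL Qᵀ)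
    (fun X => by rw [mulL_apply, mulL_apply, ← Matrix.mul_assoc, hQ1, Matrix.one_mul])
    (fun X => by rw [mulL_apply, mulL_apply, ← Matrix.mul_assoc, hQ2, Matrix.one_mul])
  have he : ∀ X, e X = Q * X := fun X => rfl
  have h1 : (fun X => (D X F) ^ 2) =ᶠ[𝓝 F] (fun X => (D X (Q * F)) ^ 2) ∘ e := by
    filter_upwards [isOpen_GLp.mem_nhds hF] with X hX
    show _ = (D (Q * X) (Q * F)) ^ 2
    rw [hD.frame_indiff Q hQ Q hQ X hX F hF]
  exact h2_equiv e h1 G G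

lemma frobSq_pos {S : Mat3} (h : S ≠ 0) : 0 < frobSq S := by
  by_contra hn
  apply h
  have h0 : frobSq S = 0 := le_antisymm (not_lt.mp hn)
    (Finset.sum_nonneg fun i _ => Finset.sum_nonneg fun j _ => sq_nonneg _)
  unfold frobSq at h0
  have h0' := (Finset.sum_eq_zero_iff_of_nonneg
    (fun i _ => Finset.sum_nonneg fun j _ => sq_nonneg _)).mp h0
  ext i j
  have h1 := (Finset.sum_eq_zero_iff_of_nonneg (fun j _ => sq_nonneg _)).mp
    (h0' i (Finset.mem_univ _))
  exact pow_eq_zero_iff (two_ne_zero) |>.mp (h1 j (Finset.mem_univ _))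

lemma frobSq_smul (r : ℝ) (S : Mat3) : frobSq (r • S) = r ^ 2 * frobSq S := by
  simp [frobSq, Finset.mul_sum, mul_pow]

lemma continuous_frobSq : Continuous frobSq := by
  unfold frobSq
  refine continuous_finsetSum _ fun i _ => continuous_finsetSum _ fun j _ => ?_
  exact (Continuous.matrix_elem continuous_id i j).pow 2

lemma symPart_symm {S : Mat3} (h : Sᵀ = S) : symPart S = S := by
  rw [symPart, h, ← two_smul ℝ S, smul_smul]; norm_num

lemma symPart_transpose (S : Mat3) : (symPart S)ᵀ = symPart S := by
  rw [symPart, Matrix.transpose_smul, Matrix.transpose_add, Matrix.transpose_transpose, add_comm]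

lemma one_mem_SO3 : (1 : Mat3) ∈ SO3 := by simp [SO3]

lemma local_est {D : Mat3 → Mat3 → ℝ} (hD : IsDissipationDensity D) :
    ∃ c' > (0 : ℝ), ∀ᶠ F in 𝓝 (1 : Mat3), F ∈ GLp ∧ ∀ G : Mat3,
        c' * frobSq (symPart (Fᵀ * G)) ≤ D2bil D F F G G := by
  obtain ⟨V, hV, hSV, hVG, hf⟩ := hD.smooth
  obtain ⟨c, hc, hco⟩ := hD.coercive
  have h11 : ((1 : Mat3), (1 : Mat3)) ∈ V := hSV ⟨one_mem_SO3, one_mem_SO3⟩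
  refine ⟨c / 2, by positivity, ?_⟩
  have hdiag : ∀ᶠ F in 𝓝 (1 : Mat3), (F, F) ∈ V :=
    (continuous_id.prodMk continuous_id).continuousAt.eventually (hV.mem_nhds h11)
  let f : Mat3 × Mat3 → ℝ := fun p => (D p.1 p.2) ^ 2
  let φ : Mat3 → Mat3 → ℝ := fun F S => h2 f (F, F) ((F⁻¹)ᵀ * S, 0) ((F⁻¹)ᵀ * S, 0)
  have hc1 : ContDiffAt ℝ 3 f ((1 : Mat3), (1 : Mat3)) := hf.contDiffAt (hV.mem_nhds h11)
  have hinv : ContinuousAt (fun F : Mat3 => F⁻¹) 1 := by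
    have : (fun F : Mat3 => F⁻¹) = fun F => (F.det)⁻¹ • F.adjugate := by
      funext F; rw [Matrix.inv_def, Ring.inverse_eq_inv']
    rw [this]
    refine ContinuousAt.smul (ContinuousAt.inv₀ (Continuous.matrix_det continuous_id).continuousAt
      (by simp)) (Continuous.matrix_adjugate continuous_id).continuousAt
  have hφc : ∀ S, ContinuousAt (fun z : Mat3 × Mat3 => φ z.1 z.2) (1, S) := by
    intro S
    have hi : ContinuousAt (fun z : Mat3 × Mat3 => z.1⁻¹) (1, S) :=
      ContinuousAt.comp (x := ((1 : Mat3), S)) (f := Prod.fst) (g := fun F : Mat3 => F⁻¹) hinv continuousAt_fst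
    have hT : ContinuousAt (fun z : Mat3 × Mat3 => (z.1⁻¹)ᵀ * z.2) (1, S) :=
      ContinuousAt.mul ((Continuous.matrix_transpose continuous_id).continuousAt.comp hi)
        continuousAt_snd
    have hP : ContinuousAt (fun z : Mat3 × Mat3 => ((z.1⁻¹)ᵀ * z.2, (0 : Mat3))) (1, S) :=
      hT.prodMk continuousAt_const
    have hp : ContinuousAt (fun z : Mat3 × Mat3 => (z.1, z.1)) (1, S) :=
      continuousAt_fst.prodMk continuousAt_fst
    exact h2_cont (p := fun z : Mat3 × Mat3 => (z.1, z.1)) hc1 hp hP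
  have hK : IsCompact {S : Mat3 | Sᵀ = S ∧ ‖S‖ = 1} := by
    have : {S : Mat3 | Sᵀ = S ∧ ‖S‖ = 1} = {S : Mat3 | Sᵀ = S} ∩ Metric.sphere 0 1 := by
      ext S; simp
    rw [this]
    exact (isCompact_sphere _ _).inter_left
      (isClosed_eq (Continuous.matrix_transpose continuous_id) continuous_id)
  have hev := hK.eventually_forall_of_forall_eventually (x₀ := (1 : Mat3))
    (P := fun F S => c / 2 * frobSq S < φ F S) (by
      rintro S ⟨hS, hS1⟩
      have hS0 : S ≠ 0 := by rintro rfl; simp at hS1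
      refine ContinuousAt.eventually_lt
        (f := fun z : Mat3 × Mat3 => c / 2 * frobSq z.2) ?_ (hφc S) ?_
      · exact (continuous_const.mul (continuous_frobSq.comp continuous_snd)).continuousAt
      · have h1 := hco S
        rw [symPart_symm hS, D2bil_joint hV hf h11] at h1
        have h2 : φ 1 S = h2 f (1, 1) (S, 0) (S, 0) := by simp [φ]
        have h3 := frobSq_pos hS0
        have h4 : c / 2 * frobSq S < c * frobSq S := by nlinarith
        show c / 2 * frobSq S < φ 1 S
        rw [h2]
        exact lt_of_lt_of_le h4 h1)
  filter_upwards [hdiag, hev] with F hFV hFe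
  refine ⟨(hVG hFV).1, fun G => ?_⟩
  rw [D2bil_reduce hD hV hVG hf hFV, D2bil_joint hV hf hFV]
  have hs := symPart_transpose (Fᵀ * G)
  generalize symPart (Fᵀ * G) = S at hs
  show c / 2 * frobSq S ≤ φ F S
  by_cases hS0 : S = 0
  · subst hS0
    have h1 := h2_smul_left f (F, F) 0 0 0
    have h3 : φ F 0 = 0 := by
      simp only [φ, Matrix.mul_zero]
      rw [zero_smul, zero_mul] at h1
      exact h1
    rw [h3]
    simp [frobSq]
  · have hn : ‖S‖ ≠ 0 := norm_ne_zero_iff.mpr hS0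
    have h1 := hFe (‖S‖⁻¹ • S) ⟨by rw [Matrix.transpose_smul, hs], by
      rw [norm_smul, norm_inv, norm_norm, inv_mul_cancel₀ hn]⟩
    have h2 : φ F (‖S‖⁻¹ • S) = (‖S‖⁻¹) ^ 2 * φ F S := by
      have : ((F⁻¹)ᵀ * (‖S‖⁻¹ • S), (0 : Mat3)) = ‖S‖⁻¹ • ((F⁻¹)ᵀ * S, (0 : Mat3)) := by
        rw [Prod.smul_mk, smul_zero, Matrix.mul_smul]
      simp only [φ]
      rw [this, h2_smul_left, h2_smul_right]
      ring
    rw [h2, frobSq_smul] at h1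
    have h3 : 0 < (‖S‖⁻¹) ^ 2 := by positivity
    have h4 : (‖S‖⁻¹) ^ 2 * (c / 2 * frobSq S) < (‖S‖⁻¹) ^ 2 * φ F S := by linarith
    exact le_of_lt (lt_of_mul_lt_mul_left h4 h3.le)

/-- There is an open neighborhood `U` of `SO(3)` inside `GL₊(3)` and
`c' > 0` with `∂²_{F₁²}D²(F,F)[G,G] ≥ c' |sym(FᵀG)|²` for all `F ∈ U`, `G ∈ ℝ^{3×3}`. -/
theorem statement0 (D : Mat3 → Mat3 → ℝ) (hD : IsDissipationDensity D) :
    ∃ U : Set Mat3, IsOpen U ∧ SO3 ⊆ U ∧ U ⊆ GLp ∧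
      ∃ c' > (0 : ℝ), ∀ F ∈ U, ∀ G : Mat3,
        c' * frobSq (symPart (Fᵀ * G)) ≤ D2bil D F F G G := by
  obtain ⟨c', hc', hev⟩ := local_est hD
  obtain ⟨U₀, hU₀, hUo, h1⟩ := eventually_nhds_iff.mp hev
  refine ⟨⋃ Q ∈ SO3, {F | Qᵀ * F ∈ U₀}, ?_, ?_, ?_, c', hc', ?_⟩
  · refine isOpen_biUnion fun Q _ => ?_
    exact hUo.preimage (mulL Qᵀ).continuous
  · intro Q hQ
    refine Set.mem_biUnion hQ ?_
    show Qᵀ * Q ∈ U₀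
    rw [hQ.1]; exact h1
  · intro F hF
    obtain ⟨Q, hQ, hFQ⟩ := Set.mem_iUnion₂.mp hF
    have h2 := SO3_mul_GLp hQ (hU₀ _ hFQ).1
    rwa [← Matrix.mul_assoc, mul_eq_one_comm.mp hQ.1, Matrix.one_mul] at h2
  · intro F hF G
    obtain ⟨Q, hQ, hFQ⟩ := Set.mem_iUnion₂.mp hF
    have hQ2 : Q * Qᵀ = 1 := mul_eq_one_comm.mp hQ.1
    have hFG : F ∈ GLp := by
      have h2 := SO3_mul_GLp hQ (hU₀ _ hFQ).1
      rwa [← Matrix.mul_assoc, hQ2, Matrix.one_mul] at h2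
    have h3 := (hU₀ _ hFQ).2 (Qᵀ * G)
    rw [← D2bil_rot hD (SO3_transpose hQ) hFG, Matrix.transpose_mul, Matrix.transpose_transpose,
      Matrix.mul_assoc, ← Matrix.mul_assoc Q, hQ2, Matrix.one_mul] at h3
    exact h3
end
end

section
/- Let D be a dissipation distance density. Then there exists an open neighborhood U of SO(3) contained in GL₊(3) such that for every F ∈ U and every Ḟ ∈ ℝ^{3×3} the limit lim_{ε→0} (1/(2ε²)) D(F+εḞ, F)² exists and equals (1/4)∂²_{F₁²}D²(F,F)[Ḟ,Ḟ]. -/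
open Matrix Filter Topology

noncomputable section

attribute [local instance] Matrix.normedAddCommGroup Matrix.normedSpace

theorem aux_limit {E : Type*} [NormedAddCommGroup E] [NormedSpace ℝ E] (f : E → ℝ) (F v : E)
    (hcd : ContDiffAt ℝ 3 f F) (hf0 : f F = 0) (hnn : ∀ X, 0 ≤ f X) :
    Tendsto (fun ε : ℝ => (1 / (2 * ε ^ 2)) * f (F + ε • v)) (𝓝[≠] (0 : ℝ))
      (𝓝 ((1 / 4 : ℝ) * iteratedFDeriv ℝ 2 f F ![v, v])) := by
  have hdiff : ∀ᶠ X in 𝓝 F, DifferentiableAt ℝ f X := by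
    have := hcd.eventually (by decide)
    filter_upwards [this] with X hX
    exact hX.differentiableAt (by norm_num)
  have hd2 : DifferentiableAt ℝ (fderiv ℝ f) F :=
    (hcd.fderiv_right (m := 1) (by norm_num)).differentiableAt (by norm_num)
  have hmin : IsLocalMin f F := Filter.Eventually.of_forall fun X => by
    rw [hf0]; exact hnn X
  have hfd0 : fderiv ℝ f F = 0 := hmin.fderiv_eq_zero
  have hline : ∀ t : ℝ, HasDerivAt (fun ε : ℝ => F + ε • v) v t := fun t => by
    simpa using ((hasDerivAt_id t).smul_const v).const_add F
  have htend : Tendsto (fun ε : ℝ => F + ε • v) (𝓝 0) (𝓝 F) := by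
    have := (hline 0).continuousAt.tendsto
    simpa using this
  have hg1 : ∀ᶠ ε in 𝓝 (0 : ℝ),
      HasDerivAt (fun ε : ℝ => f (F + ε • v)) (fderiv ℝ f (F + ε • v) v) ε := by
    filter_upwards [htend.eventually hdiff] with ε hε
    exact hε.hasFDerivAt.comp_hasDerivAt ε (hline ε)
  have hg2 : HasDerivAt (fun ε : ℝ => fderiv ℝ f (F + ε • v) v)
      (fderiv ℝ (fderiv ℝ f) F v v) 0 := by
    have h1 : HasFDerivAt (fderiv ℝ f) (fderiv ℝ (fderiv ℝ f) F) (F + (0 : ℝ) • v) := by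
      simpa using hd2.hasFDerivAt
    have h2 := h1.comp_hasDerivAt (0 : ℝ) (hline 0)
    simpa using h2.clm_apply (hasDerivAt_const (0 : ℝ) v)
  have hslope : Tendsto (fun ε : ℝ => fderiv ℝ f (F + ε • v) v / (4 * ε)) (𝓝[≠] 0)
      (𝓝 ((1 / 4 : ℝ) * fderiv ℝ (fderiv ℝ f) F v v)) := by
    have := (hasDerivAt_iff_tendsto_slope.1 hg2).const_mul (1 / 4 : ℝ)
    refine this.congr fun ε => ?_
    simp [slope_def_field, hfd0]
    ring
  have hmain : Tendsto (fun ε : ℝ => f (F + ε • v) / (2 * ε ^ 2)) (𝓝[≠] 0)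
      (𝓝 ((1 / 4 : ℝ) * fderiv ℝ (fderiv ℝ f) F v v)) := by
    refine HasDerivAt.lhopital_zero_nhdsNE (hg1.filter_mono nhdsWithin_le_nhds)
      (g' := fun ε => 4 * ε) ?_ ?_ ?_ ?_ hslope
    · refine Filter.Eventually.of_forall fun ε => ?_
      have := (hasDerivAt_pow 2 ε).const_mul (2 : ℝ)
      have e : (2 : ℝ) * (((2 : ℕ) : ℝ) * ε ^ (2 - 1)) = 4 * ε := by
        norm_num
        ring
      rw [e] at this
      exact this
    · filter_upwards [self_mem_nhdsWithin] with ε hε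
      exact mul_ne_zero (by norm_num) hε
    · have h : ContinuousAt f F := hcd.continuousAt
      have := h.tendsto.comp htend
      rw [hf0] at this
      exact this.mono_left nhdsWithin_le_nhds
    · have : Continuous fun ε : ℝ => 2 * ε ^ 2 := by fun_prop
      have := this.tendsto 0
      simp only [ne_eq, OfNat.ofNat_ne_zero, not_false_eq_true, zero_pow, mul_zero] at this
      exact this.mono_left nhdsWithin_le_nhds
  have hD2 : iteratedFDeriv ℝ 2 f F ![v, v] = fderiv ℝ (fderiv ℝ f) F v v := by
    simp [iteratedFDeriv_two_apply]
  rw [hD2]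
  refine hmain.congr fun ε => ?_
  ring

theorem aux_slice {E : Type*} [NormedAddCommGroup E] [NormedSpace ℝ E] (h : E → E → ℝ) (F : E)
    (V : Set (E × E)) (hV : IsOpen V) (hF : (F, F) ∈ V)
    (hC : ContDiffOn ℝ 3 (fun p : E × E => h p.1 p.2) V) :
    ContDiffAt ℝ 3 (fun X => h X F) F := by
  have h1 : ContDiffAt ℝ 3 (fun p : E × E => h p.1 p.2) (F, F) :=
    hC.contDiffAt (hV.mem_nhds hF)
  have h2 : ContDiffAt ℝ 3 (fun X : E => (X, F)) F := by fun_prop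
  exact ContDiffAt.comp (f := fun X : E => (X, F)) (g := fun p : E × E => h p.1 p.2) F h1 h2

/-- On an open neighborhood `U` of `SO(3)` inside `GL₊(3)`, the limit
`lim_{ε→0} (1/(2ε²)) D(F+εḞ, F)²` exists and equals `(1/4)∂²_{F₁²}D²(F,F)[Ḟ,Ḟ]`. -/
theorem statement5 (D : Mat3 → Mat3 → ℝ) (hD : IsDissipationDensity D) :
    ∃ U : Set Mat3, IsOpen U ∧ SO3 ⊆ U ∧ U ⊆ GLp ∧
      ∀ F ∈ U, ∀ Fdot : Mat3,
        Tendsto (fun ε : ℝ => (1 / (2 * ε ^ 2)) * (D (F + ε • Fdot) F) ^ 2)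
          (𝓝[≠] (0 : ℝ)) (𝓝 ((1 / 4 : ℝ) * D2bil D F F Fdot Fdot)) := by
  obtain ⟨V, hVo, hSV, hVG, hC⟩ := hD.smooth
  refine ⟨{F | (F, F) ∈ V}, hVo.preimage (by fun_prop), fun Q hQ => hSV ⟨hQ, hQ⟩,
    fun F hF => (hVG hF).1, ?_⟩
  intro F hF v
  have hFG : F ∈ GLp := (hVG hF).1
  have hcd := aux_slice (fun X Y : Mat3 => (D X Y) ^ 2) F V hVo hF hC
  exact aux_limit (fun X => (D X F) ^ 2) F v hcd (by simp [hD.eq_zero F hFG F hFG rfl])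
    (fun X => sq_nonneg _)
end
end

section
/- Let λ₂, λ₃ ≥ 0 and μ > 0, and define the quadratic form Q(A) := (λ₂A₂₂ + λ₃A₃₃)² + μ|A|² on the symmetric 3×3 matrices. Then: Q¹(q₁₁,q₁₂) := min{ Q(A) : A symmetric, A₁₁ = q₁₁, A₁₂ = q₁₂ } = μ q₁₁² + 2μ q₁₂²; Q⁰(q₁₁) := min_{z∈ℝ} Q¹(q₁₁,z) = μ q₁₁²; and for every symmetric A, Q(A) = Q¹(A₁₁,A₁₂) + Q*(Ã), where Ã is the symmetric matrix obtained from A by replacing the (1,1), (1,2) and (2,1) entries by 0 and Q*(Ã) := (λ₂Ã₂₂ + λ₃Ã₃₃)² + μ|Ã|². In particular Q¹(q₁₁,q₁₂) = Q⁰(q₁₁) + C* q₁₂² with C* = 2μ, so condition (H) holds for Q. -/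
open Matrix

noncomputable section

/-- The orthotropic quadratic form `Q(A) := (λ₂A₂₂ + λ₃A₃₃)² + μ|A|²`. -/
def Qform (l₂ l₃ μ : ℝ) (A : Mat3) : ℝ := (l₂ * A 1 1 + l₃ * A 2 2) ^ 2 + μ * frobSq A

/-- The matrix `Ã` obtained from `A` by replacing the `(1,1)`, `(1,2)` and `(2,1)` entries
by `0`. -/
def tilde (A : Mat3) : Mat3 :=
  Matrix.of fun i j =>
    if (i = 0 ∧ j = 0) ∨ (i = 0 ∧ j = 1) ∨ (i = 1 ∧ j = 0) then 0 else A i j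

/-- For `λ₂, λ₃ ≥ 0`, `μ > 0` and `Q(A) = (λ₂A₂₂ + λ₃A₃₃)² + μ|A|²` on
symmetric matrices: the constrained minimum `Q¹(q₁₁,q₁₂) = μq₁₁² + 2μq₁₂²`, the minimum
`Q⁰(q₁₁) = min_z Q¹(q₁₁,z) = μq₁₁²`, and `Q(A) = Q¹(A₁₁,A₁₂) + Q*(Ã)`; in particular
`Q¹(q₁₁,q₁₂) = Q⁰(q₁₁) + C*q₁₂²` with `C* = 2μ`, so condition (H) holds. -/
theorem statement9 (l₂ l₃ μ : ℝ) (hl₂ : 0 ≤ l₂) (hl₃ : 0 ≤ l₃) (hμ : 0 < μ) :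
    (∀ q₁₁ q₁₂ : ℝ,
      IsLeast {v : ℝ | ∃ A : Mat3, Aᵀ = A ∧ A 0 0 = q₁₁ ∧ A 0 1 = q₁₂ ∧ v = Qform l₂ l₃ μ A}
        (μ * q₁₁ ^ 2 + 2 * μ * q₁₂ ^ 2)) ∧
    (∀ q₁₁ : ℝ,
      IsLeast {v : ℝ | ∃ z : ℝ, v = μ * q₁₁ ^ 2 + 2 * μ * z ^ 2} (μ * q₁₁ ^ 2)) ∧
    (∀ A : Mat3, Aᵀ = A →
      Qform l₂ l₃ μ A
        = (μ * (A 0 0) ^ 2 + 2 * μ * (A 0 1) ^ 2) + Qform l₂ l₃ μ (tilde A)) ∧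
    (∀ q₁₁ q₁₂ : ℝ,
      μ * q₁₁ ^ 2 + 2 * μ * q₁₂ ^ 2 = μ * q₁₁ ^ 2 + (2 * μ) * q₁₂ ^ 2) := by
  have key : ∀ A : Mat3, Aᵀ = A →
      Qform l₂ l₃ μ A
        = (μ * (A 0 0) ^ 2 + 2 * μ * (A 0 1) ^ 2) + Qform l₂ l₃ μ (tilde A) := by
    intro A hA
    have h : A 1 0 = A 0 1 := congrFun (congrFun hA 0) 1
    simp [Qform, frobSq, tilde, Fin.sum_univ_three, h]
    ring
  have nn : ∀ A : Mat3, 0 ≤ Qform l₂ l₃ μ A := by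
    intro A
    unfold Qform frobSq
    positivity
  refine ⟨fun a b => ⟨⟨!![a, b, 0; b, 0, 0; 0, 0, 0], ?_, by simp, by simp, ?_⟩, ?_⟩,
    fun a => ⟨⟨0, by simp⟩, ?_⟩, key, fun _ _ => rfl⟩
  · ext i j
    fin_cases i <;> fin_cases j <;> simp
  · simp [Qform, frobSq, Fin.sum_univ_three]
    ring
  · rintro v ⟨A, hA, rfl, rfl, rfl⟩
    rw [key A hA]
    linarith [nn (tilde A)]
  · rintro v ⟨z, rfl⟩
    have : 0 ≤ 2 * μ * z ^ 2 := by positivity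
    linarith
end
end

section
/- Let D be a dissipation distance density and set Q³_D(A) := (1/2)∂²_{F₁²}D²(Id,Id)[A,A]. Then there exist constants C > 0 and δ > 0 such that for all F₀, F₁ ∈ ℝ^{3×3} with |F₀ − Id| ≤ δ and |F₁ − Id| ≤ δ one has |D(F₀,F₁)² − Q³_D(F₁ − F₀)| ≤ C |F₁ − F₀|² (|F₀ − Id| + |F₁ − F₀|). -/
open Matrix Filter Topology

noncomputable section

attribute [local instance] Matrix.normedAddCommGroup Matrix.normedSpace

/-- The quadratic form `Q³_D(A) := (1/2)∂²_{F₁²}D²(Id,Id)[A,A]`. -/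
def Q3D (D : Mat3 → Mat3 → ℝ) (A : Mat3) : ℝ := (1 / 2 : ℝ) * D2bil D 1 1 A A

/-- One-dimensional second order estimate. -/
lemma taylor_one_dim (φ φ' φ'' : ℝ → ℝ) (q M : ℝ)
    (h1 : ∀ t ∈ Set.Icc (0:ℝ) 1, HasDerivAt φ (φ' t) t)
    (h2 : ∀ t ∈ Set.Icc (0:ℝ) 1, HasDerivAt φ' (φ'' t) t)
    (z0 : φ 0 = 0) (z1 : φ' 0 = 0)
    (hM : ∀ t ∈ Set.Icc (0:ℝ) 1, |φ'' t - q| ≤ M) :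
    |φ 1 - 1 / 2 * q| ≤ M := by
  have hM0 : 0 ≤ M := (abs_nonneg _).trans (hM 0 (by simp))
  have A : ∀ t ∈ Set.Icc (0:ℝ) 1, |φ' t - t * q| ≤ M := by
    intro t ht
    have := Convex.norm_image_sub_le_of_norm_hasDerivWithin_le (f := fun t => φ' t - t * q)
      (f' := fun t => φ'' t - q) (s := Set.Icc (0:ℝ) 1) (C := M) (x := 0) (y := t)
      (fun x hx => by
        have := (h2 x hx).sub ((hasDerivAt_id x).mul_const q)
        rw [one_mul] at this
        exact this.hasDerivWithinAt)
      (fun x hx => by simpa using hM x hx) (convex_Icc 0 1) (by simp) ht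
    simp only [z1, zero_mul, sub_zero, Real.norm_eq_abs] at this
    rw [abs_of_nonneg ht.1] at this
    nlinarith [ht.2]
  have := Convex.norm_image_sub_le_of_norm_hasDerivWithin_le (f := fun t => φ t - 1 / 2 * t ^ 2 * q)
      (f' := fun t => φ' t - t * q) (s := Set.Icc (0:ℝ) 1) (C := M) (x := 0) (y := 1)
      (fun x hx => by
        have := (h1 x hx).sub ((((hasDerivAt_id x).pow 2).const_mul (1 / 2)).mul_const q)
        have h3 : HasDerivAt (fun t => φ t - 1 / 2 * t ^ 2 * q) (φ' x - x * q) x := by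
          refine HasDerivAt.congr_deriv this ?_
          simp
        exact h3.hasDerivWithinAt)
      (fun x hx => by simpa using A x hx) (convex_Icc 0 1) (by simp) (by simp)
  simpa [z0] using this

lemma taylor_general {E : Type*} [NormedAddCommGroup E] [NormedSpace ℝ E] (f : E × E → ℝ) (a : E)
    (hf : ContDiffAt ℝ 3 f (a, a)) (h0 : ∀ᶠ p in 𝓝 (a, a), f (p.1, p.1) = 0)
    (hn : ∀ᶠ p in 𝓝 (a, a), 0 ≤ f p) :
    ∃ C > (0:ℝ), ∃ δ > (0:ℝ), ∀ F₀ F₁ : E, ‖F₀ - a‖ ≤ δ → ‖F₁ - a‖ ≤ δ →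
      |f (F₁, F₀) - 1 / 2 * iteratedFDeriv ℝ 2 (fun F => f (F, a)) a ![F₁ - F₀, F₁ - F₀]|
        ≤ C * ‖F₁ - F₀‖ ^ 2 * (‖F₀ - a‖ + ‖F₁ - F₀‖) := by
  have hf1 : ContDiffAt ℝ 2 (fderiv ℝ f) (a, a) := hf.fderiv_right (by norm_num)
  have hf2 : ContDiffAt ℝ 1 (fderiv ℝ (fderiv ℝ f)) (a, a) := hf1.fderiv_right (by norm_num)
  obtain ⟨K, s, hs, hK⟩ := hf2.exists_lipschitzOnWith
  have e1 : ∀ᶠ p in 𝓝 (a, a), DifferentiableAt ℝ f p :=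
    (hf.eventually (by simp)).mono fun p hp => hp.differentiableAt (by simp)
  have e2 : ∀ᶠ p in 𝓝 (a, a), DifferentiableAt ℝ (fderiv ℝ f) p :=
    (hf1.eventually (by simp)).mono fun p hp => hp.differentiableAt (by simp)
  have hH : ∀ G : E, iteratedFDeriv ℝ 2 (fun F => f (F, a)) a ![G, G]
      = fderiv ℝ (fderiv ℝ f) (a, a) (G, 0) (G, 0) := by
    intro G
    rw [iteratedFDeriv_two_apply]
    have hpair : ∀ F : E, HasFDerivAt (fun F : E => (F, a)) (ContinuousLinearMap.inl ℝ E E) F :=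
      fun F => hasFDerivAt_prodMk_left F a
    have ev : fderiv ℝ (fun F => f (F, a)) =ᶠ[𝓝 a]
        fun F => (fderiv ℝ f (F, a)).comp (ContinuousLinearMap.inl ℝ E E) := by
      have : Tendsto (fun F : E => (F, a)) (𝓝 a) (𝓝 (a, a)) := (hpair a).continuousAt
      filter_upwards [this.eventually e1] with F hF
      exact (hF.hasFDerivAt.comp F (hpair F)).fderiv
    rw [ev.fderiv_eq]
    have h3 : HasFDerivAt (fun F : E => fderiv ℝ f (F, a))
        ((fderiv ℝ (fderiv ℝ f) (a, a)).comp (ContinuousLinearMap.inl ℝ E E)) a :=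
      HasFDerivAt.comp a (e2.self_of_nhds).hasFDerivAt (hpair a)
    have h4 := h3.clm_comp (hasFDerivAt_const (ContinuousLinearMap.inl ℝ E E) a)
    rw [h4.fderiv]
    simp
  obtain ⟨ε, hε, hball⟩ := Metric.eventually_nhds_iff_ball.1
    (e1.and (e2.and (h0.and (hn.and hs))))
  refine ⟨K + 1, by positivity, ε / 2, by positivity, fun F₀ F₁ hF₀ hF₁ => ?_⟩
  set H := F₁ - F₀ with hHdef
  rw [hH]
  have hmem : ∀ t ∈ Set.Icc (0:ℝ) 1, (F₀ + t • H, F₀) ∈ Metric.ball (a, a) ε := by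
    intro t ht
    have h1 : F₀ + t • H ∈ Metric.closedBall a (ε / 2) :=
      (convex_closedBall a (ε / 2)).add_smul_sub_mem (by simpa [dist_eq_norm] using hF₀)
        (by simpa [dist_eq_norm] using hF₁) ht
    rw [Metric.mem_closedBall] at h1
    rw [Metric.mem_ball, Prod.dist_eq]
    refine max_lt (by simpa using h1.trans_lt (by linarith)) ?_
    simp only [dist_eq_norm]
    linarith
  have hdist : ∀ t ∈ Set.Icc (0:ℝ) 1, ‖(F₀ + t • H, F₀) - (a, a)‖ ≤ ‖F₀ - a‖ + ‖H‖ := by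
    intro t ht
    rw [Prod.mk_sub_mk, Prod.norm_mk]
    refine max_le ?_ (by simp)
    have : F₀ + t • H - a = (F₀ - a) + t • H := by abel
    rw [this]
    refine (norm_add_le _ _).trans ?_
    rw [norm_smul, Real.norm_eq_abs, abs_of_nonneg ht.1]
    nlinarith [ht.2, norm_nonneg H]
  have hcurve : ∀ t : ℝ, HasDerivAt (fun t : ℝ => (F₀ + t • H, F₀)) (H, (0:E)) t := by
    intro t
    have := (((hasDerivAt_id t).smul_const H).const_add F₀).prodMk (hasDerivAt_const t F₀)
    simpa using this
  have key := taylor_one_dim (fun t => f (F₀ + t • H, F₀))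
    (fun t => fderiv ℝ f (F₀ + t • H, F₀) (H, 0))
    (fun t => fderiv ℝ (fderiv ℝ f) (F₀ + t • H, F₀) (H, 0) (H, 0))
    (fderiv ℝ (fderiv ℝ f) (a, a) (H, 0) (H, 0))
    ((K + 1) * ‖H‖ ^ 2 * (‖F₀ - a‖ + ‖H‖)) ?_ ?_ ?_ ?_ ?_
  · simpa [hHdef] using key
  · intro t ht
    exact (hball _ (hmem t ht)).1.hasFDerivAt.comp_hasDerivAt t (hcurve t)
  · intro t ht
    have h5 : HasDerivAt (fun t : ℝ => fderiv ℝ f (F₀ + t • H, F₀))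
        (fderiv ℝ (fderiv ℝ f) (F₀ + t • H, F₀) (H, 0)) t :=
      (hball _ (hmem t ht)).2.1.hasFDerivAt.comp_hasDerivAt t (hcurve t)
    simpa using h5.clm_apply (hasDerivAt_const t ((H, 0) : E × E))
  · have := (hball _ (hmem 0 (by simp))).2.2.1
    simpa using this
  · have hm := hmem 0 (by simp)
    have hz := (hball _ hm).2.2.1
    simp only [zero_smul, add_zero] at hm hz ⊢
    have hmin : IsLocalMin f (F₀, F₀) := by
      filter_upwards [Metric.isOpen_ball.mem_nhds hm] with p hp
      rw [hz]
      exact (hball p hp).2.2.2.1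
    rw [hmin.fderiv_eq_zero]
    simp
  · intro t ht
    have hL := hK.norm_sub_le (hball _ (hmem t ht)).2.2.2.2 (mem_of_mem_nhds hs)
    have hnH : ‖((H, 0) : E × E)‖ = ‖H‖ := by simp [Prod.norm_mk]
    have h6 := ContinuousLinearMap.le_opNorm₂
      (fderiv ℝ (fderiv ℝ f) (F₀ + t • H, F₀) - fderiv ℝ (fderiv ℝ f) (a, a)) (H, 0) (H, 0)
    simp only [_root_.sub_apply, Real.norm_eq_abs, hnH] at h6
    refine h6.trans ?_
    have hd := hdist t ht
    have h7 : ‖fderiv ℝ (fderiv ℝ f) (F₀ + t • H, F₀) - fderiv ℝ (fderiv ℝ f) (a, a)‖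
        ≤ (K + 1) * (‖F₀ - a‖ + ‖H‖) := by
      refine hL.trans ?_
      gcongr
      linarith
    calc _ ≤ ((K + 1) * (‖F₀ - a‖ + ‖H‖)) * ‖H‖ * ‖H‖ := by gcongr
      _ = _ := by ring

lemma norm_le_frobNorm (A : Mat3) : ‖A‖ ≤ frobNorm A := by
  unfold frobNorm
  rw [Matrix.norm_le_iff (Real.sqrt_nonneg _)]
  intro i j
  refine Real.le_sqrt_of_sq_le ?_
  rw [Real.norm_eq_abs, sq_abs]
  unfold frobSq
  refine le_trans ?_ (Finset.single_le_sum (f := fun i => ∑ j, (A i j) ^ 2)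
    (fun i _ => Finset.sum_nonneg fun j _ => sq_nonneg _) (Finset.mem_univ i))
  exact Finset.single_le_sum (f := fun j => (A i j) ^ 2) (fun j _ => sq_nonneg _)
    (Finset.mem_univ j)

lemma frobNorm_sq (A : Mat3) : frobNorm A ^ 2 = frobSq A :=
  Real.sq_sqrt (Finset.sum_nonneg fun _ _ => Finset.sum_nonneg fun _ _ => sq_nonneg _)

/-- Quantitative Taylor expansion of `D²` near the identity:
`|D(F₀,F₁)² − Q³_D(F₁−F₀)| ≤ C|F₁−F₀|²(|F₀−Id| + |F₁−F₀|)` for `F₀,F₁` `δ`-close to `Id`. -/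
theorem statement11 (D : Mat3 → Mat3 → ℝ) (hD : IsDissipationDensity D) :
    ∃ C > (0 : ℝ), ∃ δ > (0 : ℝ), ∀ F₀ F₁ : Mat3,
      frobNorm (F₀ - 1) ≤ δ → frobNorm (F₁ - 1) ≤ δ →
      |(D F₀ F₁) ^ 2 - Q3D D (F₁ - F₀)|
        ≤ C * frobSq (F₁ - F₀) * (frobNorm (F₀ - 1) + frobNorm (F₁ - F₀)) := by
  obtain ⟨V, hV, hSV, hVG, hs⟩ := hD.smooth
  have h1 : (1 : Mat3) ∈ SO3 := by simp [SO3]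
  have hmem : ((1 : Mat3), (1 : Mat3)) ∈ V := hSV ⟨h1, h1⟩
  have hVn : V ∈ 𝓝 ((1 : Mat3), (1 : Mat3)) := hV.mem_nhds hmem
  obtain ⟨C, hC, δ, hδ, h⟩ := taylor_general (fun p : Mat3 × Mat3 => (D p.1 p.2) ^ 2) 1
    (hs.contDiffAt hVn)
    (by
      filter_upwards [hVn] with p hp
      have := hD.eq_zero p.1 (hVG hp).1 p.1 (hVG hp).1 rfl
      simp [this])
    (Eventually.of_forall fun p => sq_nonneg _)
  obtain ⟨ε, hε, hball⟩ := Metric.mem_nhds_iff.1 hVn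
  refine ⟨C, hC, min δ (ε / 2), by positivity, fun F₀ F₁ hF₀ hF₁ => ?_⟩
  have n0 := (norm_le_frobNorm _).trans hF₀
  have n1 := (norm_le_frobNorm _).trans hF₁
  have hV1 : (F₁, F₀) ∈ V := by
    apply hball
    rw [Metric.mem_ball, Prod.dist_eq]
    simp only [dist_eq_norm]
    have := min_le_right δ (ε / 2)
    exact max_lt (by linarith) (by linarith)
  rw [hD.symm F₀ (hVG hV1).2 F₁ (hVG hV1).1]
  refine (h F₀ F₁ (n0.trans (min_le_left _ _)) (n1.trans (min_le_left _ _))).trans ?_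
  rw [← frobNorm_sq]
  have := norm_le_frobNorm (F₁ - F₀)
  have := norm_le_frobNorm (F₀ - 1)
  gcongr
end
end

section
/- Let D : GL₊(3) × GL₊(3) → [0,∞) satisfy conditions (i)–(v) of a dissipation distance density (condition (vi) is not needed). Then the skew-symmetric matrices are contained in the kernel of the second derivative of D² at the identity: for every skew A ∈ ℝ^{3×3} and every G ∈ ℝ^{3×3}, ∂²_{F₁²}D²(Id,Id)[A,G] = 0, where ∂²_{F₁²}D²(Id,Id)[·,·] is the symmetric bilinear form given by the second Fréchet derivative of F ↦ D(F,Id)² at F = Id. -/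
open Matrix Filter Topology

noncomputable section

attribute [local instance] Matrix.normedAddCommGroup Matrix.normedSpace

lemma skew_curve (A : Mat3) (hA : Aᵀ = -A) (s r : ℝ)
    (h : s ^ 2 + r ^ 2 * (A 0 1 ^ 2 + A 0 2 ^ 2 + A 1 2 ^ 2) = 2 * r) :
    (1 + s • A + r • (A * A)) ∈ SO3 := by
  have e : ∀ i j, A j i = - A i j := fun i j => by
    have := congrFun (congrFun hA i) j
    simpa using this
  obtain ⟨a, ha⟩ : ∃ a, A 0 1 = a := ⟨_, rfl⟩
  obtain ⟨b, hb⟩ : ∃ a, A 0 2 = a := ⟨_, rfl⟩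
  obtain ⟨c, hc⟩ : ∃ a, A 1 2 = a := ⟨_, rfl⟩
  have h00 : A 0 0 = 0 := by linarith [e 0 0]
  have h11 : A 1 1 = 0 := by linarith [e 1 1]
  have h22 : A 2 2 = 0 := by linarith [e 2 2]
  have hA' : A = !![0, a, b; -a, 0, c; -b, -c, 0] := by
    ext i j
    fin_cases i <;> fin_cases j <;> simp [h00, h11, h22, ha, hb, hc, e 0 1, e 0 2, e 1 2]
  rw [ha, hb, hc] at h
  subst hA'
  have hM : (1 + s • !![0, a, b; -a, 0, c; -b, -c, 0] + r • (!![0, a, b; -a, 0, c; -b, -c, 0] *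
      !![0, a, b; -a, 0, c; -b, -c, 0]) : Mat3) =
      !![1 - r * (a^2+b^2), s * a - r * (b*c), s * b + r * (a*c);
         -s * a - r * (b*c), 1 - r*(a^2+c^2), s * c - r * (a*b);
         -s * b + r * (a*c), -s*c - r*(a*b), 1 - r*(b^2+c^2)] := by
    ext i j
    fin_cases i <;> fin_cases j <;>
      simp [Matrix.mul_apply, Fin.sum_univ_three] <;> first | (left; ring) | ring_nf <;> simp
  rw [hM]
  refine ⟨?_, ?_⟩
  · ext i j
    fin_cases i <;> fin_cases j <;>
      simp [Matrix.mul_apply, Fin.sum_univ_three]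
    · linear_combination (a^2+b^2) * h
    · linear_combination (b*c) * h
    · linear_combination (-a*c) * h
    · linear_combination (b*c) * h
    · linear_combination (a^2+c^2) * h
    · linear_combination (a*b) * h
    · linear_combination (-a*c) * h
    · linear_combination (a*b) * h
    · linear_combination (b^2+c^2) * h
  · rw [Matrix.det_fin_three]
    simp
    linear_combination (a^2+b^2+c^2) * h

lemma iter_two_zero {E : Type*} [NormedAddCommGroup E] [NormedSpace ℝ E] (f : E → ℝ) (x v w : E)
    (hfc : ContDiffAt ℝ 2 f x) (Q : ℝ → E) (hQ0 : Q 0 = x) (hQd : HasDerivAt Q ((2 : ℝ) • v) 0)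
    (hz : ∀ t, fderiv ℝ f (Q t) = 0) : iteratedFDeriv ℝ 2 f x ![v, w] = 0 := by
  have hd : DifferentiableAt ℝ (fderiv ℝ f) x :=
    (hfc.fderiv_right (m := 1) (by norm_num)).differentiableAt (by norm_num)
  rw [iteratedFDeriv_two_apply]
  have hd' : HasFDerivAt (fderiv ℝ f) (fderiv ℝ (fderiv ℝ f) x) (Q 0) := by
    rw [hQ0]; exact hd.hasFDerivAt
  have hc := hd'.comp_hasDerivAt (0:ℝ) hQd
  have hz : (fderiv ℝ f ∘ Q) = fun _ => 0 := by
    funext t; exact hz t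
  rw [hz] at hc
  have h0 := hc.unique (hasDerivAt_const (0:ℝ) _)
  rw [map_smul] at h0
  have h3 : fderiv ℝ (fderiv ℝ f) x v = 0 := by
    simpa using h0
  simp [h3]

/-- If `D` satisfies conditions (i)–(v) of a dissipation distance density
(coercivity (vi) is not needed), then the skew-symmetric matrices lie in the kernel of the
second derivative of `F ↦ D(F,Id)²` at `Id`: `∂²_{F₁²}D²(Id,Id)[A,G] = 0` for all skew `A`
and all `G`. -/
theorem statement14 (D : Mat3 → Mat3 → ℝ)
    (nonneg : ∀ F₁ ∈ GLp, ∀ F₂ ∈ GLp, 0 ≤ D F₁ F₂)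
    (eq_zero : ∀ F₁ ∈ GLp, ∀ F₂ ∈ GLp, F₁ᵀ * F₁ = F₂ᵀ * F₂ → D F₁ F₂ = 0)
    (pos_of_ne : ∀ F₁ ∈ GLp, ∀ F₂ ∈ GLp, F₁ᵀ * F₁ ≠ F₂ᵀ * F₂ → 0 < D F₁ F₂)
    (symm : ∀ F₁ ∈ GLp, ∀ F₂ ∈ GLp, D F₁ F₂ = D F₂ F₁)
    (triangle : ∀ F₁ ∈ GLp, ∀ F₂ ∈ GLp, ∀ F₃ ∈ GLp, D F₁ F₃ ≤ D F₁ F₂ + D F₂ F₃)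
    (smooth : ∃ V : Set (Mat3 × Mat3), IsOpen V ∧ SO3 ×ˢ SO3 ⊆ V ∧ V ⊆ GLp ×ˢ GLp ∧
      ContDiffOn ℝ 3 (fun p : Mat3 × Mat3 => (D p.1 p.2) ^ 2) V)
    (frame_indiff : ∀ Q₁ ∈ SO3, ∀ Q₂ ∈ SO3, ∀ F₁ ∈ GLp, ∀ F₂ ∈ GLp,
      D (Q₁ * F₁) (Q₂ * F₂) = D F₁ F₂) :
    ∀ A G : Mat3, Aᵀ = -A →
      iteratedFDeriv ℝ 2 (fun F => (D F 1) ^ 2) 1 ![A, G] = 0 := by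
  intro A G hA
  obtain ⟨V, hVo, hSV, -, hV⟩ := smooth
  have h1S : (1 : Mat3) ∈ SO3 := by simp [SO3]
  have hSG : ∀ Q ∈ SO3, Q ∈ GLp := fun Q hQ => by
    change 0 < Q.det
    rw [hQ.2]; norm_num
  set f : Mat3 → ℝ := fun F => (D F 1) ^ 2 with hf
  have hf0 : ∀ Q ∈ SO3, fderiv ℝ f Q = 0 := fun Q hQ => by
    apply IsLocalMin.fderiv_eq_zero
    refine Filter.Eventually.of_forall fun F => ?_
    have : D Q 1 = 0 := eq_zero Q (hSG Q hQ) 1 (hSG 1 h1S) (by rw [hQ.1]; simp)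
    simp only [hf, this]
    nlinarith [sq_nonneg (D F 1)]
  have hfc : ContDiffAt ℝ 3 f 1 := by
    have h2 : ContDiffAt ℝ 3 (fun p : Mat3 × Mat3 => (D p.1 p.2) ^ 2) ((1 : Mat3), (1 : Mat3)) :=
      hV.contDiffAt (hVo.mem_nhds (hSV ⟨h1S, h1S⟩))
    exact ContDiffAt.comp (1 : Mat3) (f := fun F : Mat3 => (F, (1 : Mat3))) h2
      (contDiffAt_id.prodMk contDiffAt_const)
  obtain ⟨w, hw⟩ : ∃ w, A 0 1 ^ 2 + A 0 2 ^ 2 + A 1 2 ^ 2 = w := ⟨_, rfl⟩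
  have hw0 : 0 ≤ w := by rw [← hw]; positivity
  have hne : ∀ t : ℝ, 1 + t ^ 2 * w ≠ 0 := fun t => by positivity
  let Q : ℝ → Mat3 := fun t =>
    1 + (2 * t / (1 + t ^ 2 * w)) • A + (2 * t ^ 2 / (1 + t ^ 2 * w)) • (A * A)
  have hQ : ∀ t, Q t ∈ SO3 := fun t => by
    apply skew_curve A hA
    rw [hw]
    have := hne t
    field_simp
  have hQ0 : Q 0 = 1 := by simp [Q]
  have hden : HasDerivAt (fun t : ℝ => 1 + t ^ 2 * w) 0 0 := by
    have := (((hasDerivAt_id (0:ℝ)).pow 2).mul_const w).const_add 1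
    simpa using this
  have hs : HasDerivAt (fun t : ℝ => 2 * t / (1 + t ^ 2 * w)) 2 0 := by
    have := ((hasDerivAt_id (0:ℝ)).const_mul 2).fun_div hden (hne 0)
    simpa using this
  have hr : HasDerivAt (fun t : ℝ => 2 * t ^ 2 / (1 + t ^ 2 * w)) 0 0 := by
    have := (((hasDerivAt_id (0:ℝ)).pow 2).const_mul 2).fun_div hden (hne 0)
    simpa using this
  have hQd : HasDerivAt Q ((2:ℝ) • A) 0 := by
    have := ((hs.smul_const A).const_add 1).add (hr.smul_const (A * A))
    rw [zero_smul, add_zero] at this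
    exact this
  exact iter_two_zero f 1 A G (hfc.of_le (by norm_num)) Q hQ0 hQd fun t => hf0 _ (hQ t)
end
end
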